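/- Let A be the unital associative ℂ-algebra with generators T_w (w ∈ W_ℓ) and y_1,…,y_ℓ, subject to the relations T_w T_{w′} = T_{ww′} and T_e = 1 (w, w′ ∈ W_ℓ), T_w y_m = y_{w(m)} T_w (w ∈ W_ℓ, 1 ≤ m ≤ ℓ), and y_m y_p − y_p y_m = −(y_m − y_p) T_{s_{mp}} (1 ≤ m ≠ p ≤ ℓ). Then the algebra homomorphism A → H_ℓ determined by T_w ↦ w and y_m ↦ ε_m − Σ_{j<m} s_{jm} is an isomorphism of ℂ-algebras. -/

import Mathlib

set_option synthInstance.maxHeartbeats 1000000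
set_option maxHeartbeats 1000000

noncomputable section

open scoped TensorProduct

/-- Generators of the degenerate affine Hecke algebra `H_ℓ`:
the group elements `w ∈ W_ℓ` and the polynomial generators `ε_i`. -/
inductive HGen (ℓ : ℕ) : Type
  | perm : Equiv.Perm (Fin ℓ) → HGen ℓ
  | eps : Fin ℓ → HGen ℓ

/-- Defining relations of the degenerate affine Hecke algebra: `ℂ[W_ℓ]` is a subalgebra,
`ℂ[ε_1,…,ε_ℓ]` is a (commutative polynomial) subalgebra, and the cross relation
`s_i ε_j − ε_{s_i(j)} s_i = −(δ_{i,j} − δ_{i+1,j})`. -/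
inductive HRel (ℓ : ℕ) : FreeAlgebra ℂ (HGen ℓ) → FreeAlgebra ℂ (HGen ℓ) → Prop
  | permMul (w w' : Equiv.Perm (Fin ℓ)) :
      HRel ℓ (FreeAlgebra.ι ℂ (HGen.perm w) * FreeAlgebra.ι ℂ (HGen.perm w'))
        (FreeAlgebra.ι ℂ (HGen.perm (w * w')))
  | permOne :
      HRel ℓ (FreeAlgebra.ι ℂ (HGen.perm 1)) 1
  | epsComm (i j : Fin ℓ) :
      HRel ℓ (FreeAlgebra.ι ℂ (HGen.eps i) * FreeAlgebra.ι ℂ (HGen.eps j))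
        (FreeAlgebra.ι ℂ (HGen.eps j) * FreeAlgebra.ι ℂ (HGen.eps i))
  | cross (i j : Fin ℓ) (h : (i : ℕ) + 1 < ℓ) :
      HRel ℓ
        (FreeAlgebra.ι ℂ (HGen.perm (Equiv.swap i ⟨(i : ℕ) + 1, h⟩)) *
            FreeAlgebra.ι ℂ (HGen.eps j) -
          FreeAlgebra.ι ℂ (HGen.eps (Equiv.swap i ⟨(i : ℕ) + 1, h⟩ j)) *
            FreeAlgebra.ι ℂ (HGen.perm (Equiv.swap i ⟨(i : ℕ) + 1, h⟩)))
        ((-(((if j = i then 1 else 0) : ℂ) - (if j = ⟨(i : ℕ) + 1, h⟩ then 1 else 0))) • 1)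

/-- The degenerate affine Hecke algebra `H_ℓ`, as the algebra presented by the above
generators and relations. -/
abbrev Hecke (ℓ : ℕ) : Type := RingQuot (HRel ℓ)

/-- The image of `w ∈ W_ℓ` in `H_ℓ`. -/
def Hecke.sigma {ℓ : ℕ} (w : Equiv.Perm (Fin ℓ)) : Hecke ℓ :=
  RingQuot.mkAlgHom ℂ (HRel ℓ) (FreeAlgebra.ι ℂ (HGen.perm w))

/-- The image of `ε_i` in `H_ℓ`. -/
def Hecke.eps {ℓ : ℕ} (i : Fin ℓ) : Hecke ℓ :=
  RingQuot.mkAlgHom ℂ (HRel ℓ) (FreeAlgebra.ι ℂ (HGen.eps i))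

/-- The elements `y_m := ε_m − Σ_{j<m} s_{jm}` of `H_ℓ`. -/
def Hecke.y {ℓ : ℕ} (m : Fin ℓ) : Hecke ℓ :=
  Hecke.eps m - ∑ j ∈ Finset.univ.filter (fun j : Fin ℓ => j < m), Hecke.sigma (Equiv.swap j m)

/-- Index type for the Yangian generators `t_{ij}^{(d)}`. -/
def tIdx (n : ℕ) : Type := Fin n × Fin n × ℕ

/-- `t_{ij}^{(d)}` in the free algebra, for `d : ℤ`, with the convention
`t_{ij}^{(-1)} = δ_{ij}·1` (and junk value `0` for `d ≤ -2`, which never occurs). -/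
def tFree {n : ℕ} (i j : Fin n) (d : ℤ) : FreeAlgebra ℂ (tIdx n) :=
  if d = -1 then (if i = j then 1 else 0)
  else if 0 ≤ d then FreeAlgebra.ι ℂ ((i, j, d.toNat) : tIdx n) else 0

/-- Defining relations of the Yangian `Y(gl_n)`:
`[t_{ij}^{(r)}, t_{kl}^{(s−1)}] − [t_{ij}^{(r−1)}, t_{kl}^{(s)}]
  = t_{kj}^{(r−1)} t_{il}^{(s−1)} − t_{kj}^{(s−1)} t_{il}^{(r−1)}`. -/
inductive YRel (n : ℕ) : FreeAlgebra ℂ (tIdx n) → FreeAlgebra ℂ (tIdx n) → Prop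
  | rel (i j k l : Fin n) (r s : ℕ) :
      YRel n
        (tFree i j (r : ℤ) * tFree k l ((s : ℤ) - 1) - tFree k l ((s : ℤ) - 1) * tFree i j (r : ℤ)
          - (tFree i j ((r : ℤ) - 1) * tFree k l (s : ℤ)
              - tFree k l (s : ℤ) * tFree i j ((r : ℤ) - 1)))
        (tFree k j ((r : ℤ) - 1) * tFree i l ((s : ℤ) - 1) -
          tFree k j ((s : ℤ) - 1) * tFree i l ((r : ℤ) - 1))

/-- The Yangian `Y(gl_n)`. -/
abbrev Yangian (n : ℕ) : Type := RingQuot (YRel n)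

/-- The generator `t_{ij}^{(d)}`, `d ≥ 0`, of the Yangian. -/
def Yangian.t {n : ℕ} (i j : Fin n) (d : ℕ) : Yangian n :=
  RingQuot.mkAlgHom ℂ (YRel n) (FreeAlgebra.ι ℂ ((i, j, d) : tIdx n))

/-! ## The presentation of `H_ℓ` by `T_w` and `y_1,…,y_ℓ` -/

/-- Generators of the algebra `A`: the elements `T_w` (`w ∈ W_ℓ`) and `y_1,…,y_ℓ`. -/
inductive AGen (ℓ : ℕ) : Type
  | T : Equiv.Perm (Fin ℓ) → AGen ℓ
  | y : Fin ℓ → AGen ℓ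

/-- Defining relations of `A`: `T_w T_{w'} = T_{ww'}`, `T_e = 1`,
`T_w y_m = y_{w(m)} T_w`, and `y_m y_p − y_p y_m = −(y_m − y_p) T_{s_{mp}}` for `m ≠ p`. -/
inductive ARel (ℓ : ℕ) : FreeAlgebra ℂ (AGen ℓ) → FreeAlgebra ℂ (AGen ℓ) → Prop
  | Tmul (w w' : Equiv.Perm (Fin ℓ)) :
      ARel ℓ (FreeAlgebra.ι ℂ (AGen.T w) * FreeAlgebra.ι ℂ (AGen.T w'))
        (FreeAlgebra.ι ℂ (AGen.T (w * w')))
  | Tone : ARel ℓ (FreeAlgebra.ι ℂ (AGen.T 1)) 1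
  | comm (w : Equiv.Perm (Fin ℓ)) (m : Fin ℓ) :
      ARel ℓ (FreeAlgebra.ι ℂ (AGen.T w) * FreeAlgebra.ι ℂ (AGen.y m))
        (FreeAlgebra.ι ℂ (AGen.y (w m)) * FreeAlgebra.ι ℂ (AGen.T w))
  | bracket (m p : Fin ℓ) (h : m ≠ p) :
      ARel ℓ
        (FreeAlgebra.ι ℂ (AGen.y m) * FreeAlgebra.ι ℂ (AGen.y p) -
          FreeAlgebra.ι ℂ (AGen.y p) * FreeAlgebra.ι ℂ (AGen.y m))
        (-(FreeAlgebra.ι ℂ (AGen.y m) - FreeAlgebra.ι ℂ (AGen.y p)) *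
          FreeAlgebra.ι ℂ (AGen.T (Equiv.swap m p)))

/-- The algebra `A` presented by the generators `T_w`, `y_m` and the above relations. -/
abbrev APres (ℓ : ℕ) : Type := RingQuot (ARel ℓ)

/-- The image `∑_{j<m} σ (j m)` of the `m`-th Jucys–Murphy element under `σ`. -/
def jucysMurphy {ℓ : ℕ} {B : Type*} [Ring B] (σ : Equiv.Perm (Fin ℓ) →* B) (m : Fin ℓ) : B :=
  ∑ j ∈ Finset.univ.filter (fun j : Fin ℓ => j < m), σ (Equiv.swap j m)

section JucysMurphy

variable {ℓ : ℕ} {B : Type*} [Ring B] (σ : Equiv.Perm (Fin ℓ) →* B)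

theorem map_mul_map_swap (w : Equiv.Perm (Fin ℓ)) (j m : Fin ℓ) :
    σ w * σ (Equiv.swap j m) = σ (Equiv.swap (w j) (w m)) * σ w := by
  rw [← map_mul, ← map_mul, Equiv.mul_swap_eq_swap_mul]

/-- A permutation preserving `{j | j < m}` transports the `m`-th Jucys–Murphy element. -/
theorem map_mul_jucysMurphy_of_lt_iff (w : Equiv.Perm (Fin ℓ)) (m : Fin ℓ) (hm : w m = m)
    (hw : ∀ j, w j < m ↔ j < m) :
    σ w * jucysMurphy σ m = jucysMurphy σ m * σ w := by
  simp only [jucysMurphy, Finset.mul_sum, Finset.sum_mul]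
  refine Finset.sum_equiv w (fun j => by simp [hw]) (fun j _ => ?_)
  rw [map_mul_map_swap, hm]

theorem map_swap_mul_jucysMurphy {j m p : Fin ℓ} (hj : j < p) (hm : m < p) :
    σ (Equiv.swap j m) * jucysMurphy σ p = jucysMurphy σ p * σ (Equiv.swap j m) := by
  refine map_mul_jucysMurphy_of_lt_iff σ _ _
    (Equiv.swap_apply_of_ne_of_ne hj.ne' hm.ne') fun k => ?_
  rw [Equiv.swap_apply_def]
  split_ifs with h1 h2
  · subst h1; simp [hj, hm]
  · subst h2; simp [hj, hm]
  · rfl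

theorem map_swap_mul_map_swap (a b : Fin ℓ) :
    σ (Equiv.swap a b) * σ (Equiv.swap a b) = 1 := by
  rw [← map_mul, Equiv.swap_mul_self, map_one]

theorem jucysMurphy_succ (i i' : Fin ℓ) (h : (i' : ℕ) = i + 1) :
    jucysMurphy σ i' * σ (Equiv.swap i i') = σ (Equiv.swap i i') * jucysMurphy σ i + 1 := by
  have hf : Finset.univ.filter (fun j : Fin ℓ => j < i') =
      insert i (Finset.univ.filter (fun j : Fin ℓ => j < i)) := by
    ext j
    simp only [Finset.mem_filter, Finset.mem_univ, true_and, Finset.mem_insert, Fin.lt_def,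
      Fin.ext_iff]
    omega
  rw [jucysMurphy, hf, Finset.sum_insert (by simp), add_mul, map_swap_mul_map_swap, add_comm,
    jucysMurphy, Finset.mul_sum, Finset.sum_mul]
  congr 1
  refine Finset.sum_congr rfl fun j hj => ?_
  have hj : j < i := by simpa using hj
  rw [map_mul_map_swap σ (Equiv.swap i i') j i, Equiv.swap_apply_left,
    Equiv.swap_apply_of_ne_of_ne hj.ne]
  rintro rfl
  rw [Fin.lt_def] at hj
  omega

/-- Jucys–Murphy elements satisfy the cross relations of the degenerate affine Hecke algebra. -/
theorem map_swap_mul_jucysMurphy_sub [Algebra ℂ B] (i i' j : Fin ℓ) (h : (i' : ℕ) = i + 1) :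
    σ (Equiv.swap i i') * jucysMurphy σ j -
        jucysMurphy σ (Equiv.swap i i' j) * σ (Equiv.swap i i') =
      (-(((if j = i then 1 else 0) : ℂ) - (if j = i' then 1 else 0))) • (1 : B) := by
  have hne : i ≠ i' := by
    rintro rfl
    omega
  have key := jucysMurphy_succ σ i i' h
  rcases eq_or_ne j i with rfl | hji
  · rw [Equiv.swap_apply_left, key]
    simp [hne]
  rcases eq_or_ne j i' with rfl | hji'
  · rw [Equiv.swap_apply_right]
    have h2 := congrArg
      (fun x => σ (Equiv.swap i j) * x * σ (Equiv.swap i j)) key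
    simp only [mul_add, add_mul, mul_assoc, map_swap_mul_map_swap, mul_one] at h2
    simp only [← mul_assoc, map_swap_mul_map_swap, one_mul] at h2
    rw [h2]
    simp [hji]
  · have hw : ∀ k, Equiv.swap i i' k < j ↔ k < j := by
      intro k
      rw [Equiv.swap_apply_def]
      simp only [Fin.ext_iff, ne_eq] at hji hji'
      split_ifs with h1 h2
      · subst h1; simp only [Fin.lt_def]; omega
      · subst h2; simp only [Fin.lt_def]; omega
      · rfl
    have hj := Equiv.swap_apply_of_ne_of_ne hji hji'
    rw [hj, map_mul_jucysMurphy_of_lt_iff σ _ _ hj hw]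
    simp [hji, hji']

/-- Shifting an equivariant family `y` by the Jucys–Murphy elements changes its commutators by
`(y m - y p) * σ (m p)`. -/
theorem add_jucysMurphy_commutator {y : Fin ℓ → B} (hy : ∀ w m, σ w * y m = y (w m) * σ w)
    {m p : Fin ℓ} (h : m < p) :
    (y m + jucysMurphy σ m) * (y p + jucysMurphy σ p) -
        (y p + jucysMurphy σ p) * (y m + jucysMurphy σ m) =
      y m * y p - y p * y m + (y m - y p) * σ (Equiv.swap m p) := by
  have h1 : jucysMurphy σ m * y p = y p * jucysMurphy σ m := by
    rw [jucysMurphy, Finset.sum_mul, Finset.mul_sum]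
    refine Finset.sum_congr rfl fun j hj => ?_
    have hj : j < m := by simpa using hj
    rw [hy, Equiv.swap_apply_of_ne_of_ne (hj.trans h).ne' h.ne']
  have h2 : jucysMurphy σ m * jucysMurphy σ p = jucysMurphy σ p * jucysMurphy σ m := by
    rw [jucysMurphy, Finset.sum_mul, Finset.mul_sum]
    refine Finset.sum_congr rfl fun j hj => ?_
    have hj : j < m := by simpa using hj
    exact map_swap_mul_jucysMurphy σ (hj.trans h) h
  have h3 : y m * jucysMurphy σ p - jucysMurphy σ p * y m =
      (y m - y p) * σ (Equiv.swap m p) := by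
    rw [jucysMurphy, Finset.sum_mul, Finset.mul_sum, ← Finset.sum_sub_distrib,
      Finset.sum_eq_single m]
    · rw [hy, Equiv.swap_apply_left, sub_mul]
    · intro j _ hj
      rw [hy, Equiv.swap_apply_of_ne_of_ne hj.symm h.ne, sub_self]
    · simp [h]
  rw [← h3]
  simp only [add_mul, mul_add, h1, h2]
  abel

end JucysMurphy

/-- A family intertwined by the simple transpositions is intertwined by every permutation. -/
theorem equivariant_of_swap {ℓ : ℕ} {B : Type*} [Ring B] (σ : Equiv.Perm (Fin ℓ) →* B)
    {y : Fin ℓ → B}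
    (hy : ∀ i i' : Fin ℓ, (i' : ℕ) = i + 1 → ∀ m,
      σ (Equiv.swap i i') * y m = y (Equiv.swap i i' m) * σ (Equiv.swap i i'))
    (w : Equiv.Perm (Fin ℓ)) (m : Fin ℓ) : σ w * y m = y (w m) * σ w := by
  cases ℓ with
  | zero => exact m.elim0
  | succ n =>
    have hw := Equiv.Perm.mclosure_swap_castSucc_succ n ▸ Submonoid.mem_top w
    induction hw using Submonoid.closure_induction generalizing m with
    | mem x hx =>
      obtain ⟨i, rfl⟩ := hx
      exact hy _ _ (by simp) m
    | one => simp
    | mul a b _ _ ha hb =>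
      rw [map_mul, mul_assoc, hb, ← mul_assoc, ha, mul_assoc, Equiv.Perm.mul_apply]

/-- The group `W_ℓ` in the degenerate affine Hecke algebra. -/
def Hecke.sigmaHom (ℓ : ℕ) : Equiv.Perm (Fin ℓ) →* Hecke ℓ where
  toFun := Hecke.sigma
  map_one' := by
    simpa [Hecke.sigma] using RingQuot.mkAlgHom_rel ℂ (HRel.permOne (ℓ := ℓ))
  map_mul' w w' := by
    simpa [Hecke.sigma] using (RingQuot.mkAlgHom_rel ℂ (HRel.permMul w w')).symm

theorem Hecke.eps_comm {ℓ : ℕ} (i j : Fin ℓ) :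
    Hecke.eps i * Hecke.eps j = Hecke.eps j * Hecke.eps i := by
  simpa [Hecke.eps] using RingQuot.mkAlgHom_rel ℂ (HRel.epsComm i j)

theorem Hecke.sigmaHom_mul_eps_sub {ℓ : ℕ} (i i' j : Fin ℓ) (h : (i' : ℕ) = i + 1) :
    Hecke.sigmaHom ℓ (Equiv.swap i i') * Hecke.eps j -
        Hecke.eps (Equiv.swap i i' j) * Hecke.sigmaHom ℓ (Equiv.swap i i') =
      (-(((if j = i then 1 else 0) : ℂ) - (if j = i' then 1 else 0))) • 1 := by
  obtain ⟨i', hi'⟩ := i'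
  obtain rfl : i' = i + 1 := h
  have := RingQuot.mkAlgHom_rel ℂ (HRel.cross i j hi')
  rwa [map_sub, map_mul, map_mul, map_smul, map_one] at this

theorem Hecke.y_eq {ℓ : ℕ} (m : Fin ℓ) :
    Hecke.y m = Hecke.eps m - jucysMurphy (Hecke.sigmaHom ℓ) m := rfl

theorem Hecke.sigmaHom_mul_y {ℓ : ℕ} (w : Equiv.Perm (Fin ℓ)) (m : Fin ℓ) :
    Hecke.sigmaHom ℓ w * Hecke.y m = Hecke.y (w m) * Hecke.sigmaHom ℓ w := by
  refine equivariant_of_swap _ (fun i i' h m => ?_) w m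
  have h1 := (Hecke.sigmaHom_mul_eps_sub i i' m h).trans
    (map_swap_mul_jucysMurphy_sub (Hecke.sigmaHom ℓ) i i' m h).symm
  rw [Hecke.y_eq, Hecke.y_eq, mul_sub, sub_mul]
  exact sub_eq_sub_iff_sub_eq_sub.mp h1

theorem Hecke.y_commutator {ℓ : ℕ} {m p : Fin ℓ} (h : m ≠ p) :
    Hecke.y m * Hecke.y p - Hecke.y p * Hecke.y m =
      -(Hecke.y m - Hecke.y p) * Hecke.sigmaHom ℓ (Equiv.swap m p) := by
  have key : ∀ {m p : Fin ℓ}, m < p → Hecke.y m * Hecke.y p - Hecke.y p * Hecke.y m =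
      -(Hecke.y m - Hecke.y p) * Hecke.sigmaHom ℓ (Equiv.swap m p) := by
    intro m p h
    have := add_jucysMurphy_commutator (Hecke.sigmaHom ℓ) Hecke.sigmaHom_mul_y h
    simp only [Hecke.y_eq m, Hecke.y_eq p, sub_add_cancel] at this ⊢
    rw [Hecke.eps_comm, sub_self] at this
    exact (eq_neg_of_add_eq_zero_left this.symm).trans (neg_mul (α := Hecke ℓ) _ _).symm
  rcases h.lt_or_gt with h | h
  · exact key h
  · rw [← neg_sub, key h, Equiv.swap_comm, neg_sub]
    exact (neg_mul (α := Hecke ℓ) _ _).symm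

/-- The generators `T_w` of the algebra `A`. -/
def APres.sigmaHom (ℓ : ℕ) : Equiv.Perm (Fin ℓ) →* APres ℓ where
  toFun w := RingQuot.mkAlgHom ℂ (ARel ℓ) (FreeAlgebra.ι ℂ (AGen.T w))
  map_one' := by
    simpa using RingQuot.mkAlgHom_rel ℂ (ARel.Tone (ℓ := ℓ))
  map_mul' w w' := by
    simpa using (RingQuot.mkAlgHom_rel ℂ (ARel.Tmul w w')).symm

/-- The generators `y_m` of the algebra `A`. -/
def APres.y {ℓ : ℕ} (m : Fin ℓ) : APres ℓ :=
  RingQuot.mkAlgHom ℂ (ARel ℓ) (FreeAlgebra.ι ℂ (AGen.y m))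

theorem APres.sigmaHom_mul_y {ℓ : ℕ} (w : Equiv.Perm (Fin ℓ)) (m : Fin ℓ) :
    APres.sigmaHom ℓ w * APres.y m = APres.y (w m) * APres.sigmaHom ℓ w := by
  have := RingQuot.mkAlgHom_rel ℂ (ARel.comm w m)
  rwa [map_mul, map_mul] at this

theorem APres.y_commutator {ℓ : ℕ} {m p : Fin ℓ} (h : m ≠ p) :
    APres.y m * APres.y p - APres.y p * APres.y m =
      -(APres.y m - APres.y p) * APres.sigmaHom ℓ (Equiv.swap m p) := by
  have := RingQuot.mkAlgHom_rel ℂ (ARel.bracket m p h)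
  rwa [map_sub, map_mul, map_mul, map_mul, map_neg, map_sub] at this

/-- The elements `y_m + ∑_{j<m} T_{s_{jm}}` of `A`, which correspond to the `ε_m` of `H_ℓ`. -/
def APres.eps {ℓ : ℕ} (m : Fin ℓ) : APres ℓ :=
  APres.y m + jucysMurphy (APres.sigmaHom ℓ) m

theorem APres.eps_comm {ℓ : ℕ} (i j : Fin ℓ) :
    APres.eps i * APres.eps j = APres.eps j * APres.eps i := by
  have key : ∀ {m p : Fin ℓ}, m < p →
      APres.eps m * APres.eps p = APres.eps p * APres.eps m := by
    intro m p h
    have := add_jucysMurphy_commutator (APres.sigmaHom ℓ) APres.sigmaHom_mul_y h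
    rw [APres.y_commutator h.ne] at this
    exact sub_eq_zero.mp (this.trans ((add_mul _ _ _).symm.trans (by simp)))
  rcases lt_trichotomy i j with h | rfl | h
  · exact key h
  · rfl
  · exact (key h).symm

theorem APres.sigmaHom_mul_eps_sub {ℓ : ℕ} (i i' j : Fin ℓ) (h : (i' : ℕ) = i + 1) :
    APres.sigmaHom ℓ (Equiv.swap i i') * APres.eps j -
        APres.eps (Equiv.swap i i' j) * APres.sigmaHom ℓ (Equiv.swap i i') =
      (-(((if j = i then 1 else 0) : ℂ) - (if j = i' then 1 else 0))) • 1 := by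
  rw [← map_swap_mul_jucysMurphy_sub (APres.sigmaHom ℓ) i i' j h, APres.eps, APres.eps, mul_add,
    add_mul, APres.sigmaHom_mul_y, add_sub_add_left_eq_sub]

/-- The homomorphism `A → H_ℓ`. -/
def APres.toHecke (ℓ : ℕ) : APres ℓ →ₐ[ℂ] Hecke ℓ :=
  RingQuot.liftAlgHom ℂ
    ⟨FreeAlgebra.lift ℂ fun g => match g with
      | AGen.T w => Hecke.sigmaHom ℓ w
      | AGen.y m => Hecke.y m, by
    intro a b hab
    cases hab with
    | Tmul w w' => simp
    | Tone => simp
    | comm w m => simpa using Hecke.sigmaHom_mul_y w m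
    | bracket m p h =>
      simp only [map_sub, map_mul, map_neg, FreeAlgebra.lift_ι_apply]
      exact Hecke.y_commutator h⟩

theorem APres.toHecke_sigmaHom {ℓ : ℕ} (w : Equiv.Perm (Fin ℓ)) :
    APres.toHecke ℓ (APres.sigmaHom ℓ w) = Hecke.sigmaHom ℓ w := by
  simp [APres.toHecke, APres.sigmaHom]

theorem APres.toHecke_y {ℓ : ℕ} (m : Fin ℓ) : APres.toHecke ℓ (APres.y m) = Hecke.y m := by
  simp [APres.toHecke, APres.y]

/-- The homomorphism `H_ℓ → A` inverse to `APres.toHecke`. -/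
def Hecke.toAPres (ℓ : ℕ) : Hecke ℓ →ₐ[ℂ] APres ℓ :=
  RingQuot.liftAlgHom ℂ
    ⟨FreeAlgebra.lift ℂ fun g => match g with
      | HGen.perm w => APres.sigmaHom ℓ w
      | HGen.eps m => APres.eps m, by
    intro a b hab
    cases hab with
    | permMul w w' => simp
    | permOne => simp
    | epsComm i j => simpa using APres.eps_comm i j
    | cross i j h =>
      simp only [map_sub, map_mul, map_smul, map_one, FreeAlgebra.lift_ι_apply]
      exact APres.sigmaHom_mul_eps_sub i ⟨(i : ℕ) + 1, h⟩ j rfl⟩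

theorem Hecke.toAPres_sigmaHom {ℓ : ℕ} (w : Equiv.Perm (Fin ℓ)) :
    Hecke.toAPres ℓ (Hecke.sigmaHom ℓ w) = APres.sigmaHom ℓ w := by
  simp [Hecke.toAPres, Hecke.sigmaHom, Hecke.sigma]

theorem Hecke.toAPres_eps {ℓ : ℕ} (m : Fin ℓ) :
    Hecke.toAPres ℓ (Hecke.eps m) = APres.eps m := by
  simp [Hecke.toAPres, Hecke.eps]

theorem Hecke.toAPres_y {ℓ : ℕ} (m : Fin ℓ) : Hecke.toAPres ℓ (Hecke.y m) = APres.y m := by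
  simp [Hecke.y_eq, jucysMurphy, Hecke.toAPres_sigmaHom, Hecke.toAPres_eps, APres.eps]

theorem APres.toHecke_eps {ℓ : ℕ} (m : Fin ℓ) :
    APres.toHecke ℓ (APres.eps m) = Hecke.eps m := by
  simp [APres.eps, jucysMurphy, APres.toHecke_sigmaHom, APres.toHecke_y, Hecke.y_eq]

theorem APres.toHecke_comp_toAPres (ℓ : ℕ) :
    (APres.toHecke ℓ).comp (Hecke.toAPres ℓ) = AlgHom.id ℂ (Hecke ℓ) := by
  refine RingQuot.ringQuot_ext' ℂ _ _ (FreeAlgebra.hom_ext (funext fun g => ?_))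
  cases g with
  | perm w =>
    exact (congrArg _ (Hecke.toAPres_sigmaHom w)).trans (APres.toHecke_sigmaHom w)
  | eps m => exact (congrArg _ (Hecke.toAPres_eps m)).trans (APres.toHecke_eps m)

theorem Hecke.toAPres_comp_toHecke (ℓ : ℕ) :
    (Hecke.toAPres ℓ).comp (APres.toHecke ℓ) = AlgHom.id ℂ (APres ℓ) := by
  refine RingQuot.ringQuot_ext' ℂ _ _ (FreeAlgebra.hom_ext (funext fun g => ?_))
  cases g with
  | T w => exact (congrArg _ (APres.toHecke_sigmaHom w)).trans (Hecke.toAPres_sigmaHom w)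
  | y m => exact (congrArg _ (APres.toHecke_y m)).trans (Hecke.toAPres_y m)

/-- The algebra homomorphism `A → H_ℓ` determined by `T_w ↦ w` and
`y_m ↦ ε_m − Σ_{j<m} s_{jm}` is an isomorphism of `ℂ`-algebras. -/
theorem statement19 (ℓ : ℕ) (hℓ : 0 < ℓ) :
    ∃ e : APres ℓ ≃ₐ[ℂ] Hecke ℓ,
      (∀ w : Equiv.Perm (Fin ℓ),
        e (RingQuot.mkAlgHom ℂ (ARel ℓ) (FreeAlgebra.ι ℂ (AGen.T w))) = Hecke.sigma w) ∧
      (∀ m : Fin ℓ,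
        e (RingQuot.mkAlgHom ℂ (ARel ℓ) (FreeAlgebra.ι ℂ (AGen.y m))) = Hecke.y m) := by
  exact ⟨AlgEquiv.ofAlgHom (APres.toHecke ℓ) (Hecke.toAPres ℓ) (APres.toHecke_comp_toAPres ℓ)
    (Hecke.toAPres_comp_toHecke ℓ), APres.toHecke_sigmaHom, APres.toHecke_y⟩
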